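/- arXiv:1611.08693 — 2 statements merged into one kernel-verified Lean document; each statement's English description precedes it below -/
import Mathlib

section
/- Let K = ℚ(√D) be a quadratic number field with discriminant D_K, and let χ_{D_K} be the Kronecker symbol character (D_K/·), a real primitive Dirichlet character modulo |D_K|. Then for all complex s with Re(s) > 1, ζ_K(s) = ζ(s) · L(s, χ_{D_K}). -/
open scoped BigOperators NumberField

/-- The Kronecker symbol `(D/n)`: the value at `2` is extended from the Jacobi symbol by
`(D/2) = 0` if `D` is even, `1` if `D ≡ ±1 (mod 8)` and `-1` if `D ≡ ±3 (mod 8)`. -/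
noncomputable def kroneckerSym (D : ℤ) (n : ℕ) : ℤ :=
  (if D % 2 = 0 then 0 else if D % 8 = 1 ∨ D % 8 = 7 then 1 else -1) ^ (n.factorization 2) *
    jacobiSym D (ordCompl[2] n)

lemma exists_basis (K : Type*) [Field K] [NumberField K] (hK : Module.finrank ℚ K = 2) :
    ∃ (b : Module.Basis (Fin 2) ℤ (𝓞 K)), b 0 = 1 := by
  have hr : Module.finrank ℤ (𝓞 K) = 2 := by rw [NumberField.RingOfIntegers.rank, hK]
  let c := Module.finBasisOfFinrankEq ℤ (𝓞 K) hr
  set u := c.repr 1 0 with hu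
  set v := c.repr 1 1 with hv
  have h1 : (u : 𝓞 K) * c 0 + v * c 1 = 1 := by
    have := c.sum_repr 1
    simpa [Fin.sum_univ_two, zsmul_eq_mul] using this
  have hco : IsCoprime u v := by
    rw [Int.isCoprime_iff_gcd_eq_one]
    obtain ⟨x, hx⟩ := Int.gcd_dvd_left u v
    obtain ⟨y, hy⟩ := Int.gcd_dvd_right u v
    set d := Int.gcd u v
    have hd : (d : 𝓞 K) * (x * c 0 + y * c 1) = 1 := by
      rw [← h1, hx, hy]; push_cast; ring
    have hun : IsUnit (algebraMap ℤ (𝓞 K) (d : ℤ)) :=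
      IsUnit.of_mul_eq_one _ (by simpa using hd)
    have := isUnit_of_map_unit _ _ hun
    simpa [Int.isUnit_iff_natAbs_eq] using this
  obtain ⟨α, β, hab⟩ := hco
  let w : 𝓞 K := -β * c 0 + α * c 1
  have hli : LinearIndependent ℤ ![1, w] := by
    rw [LinearIndependent.pair_iff]
    intro x y hxy
    have h2 : (x * u - y * β) • c 0 + (x * v + y * α) • c 1 = 0 := by
      rw [← hxy, zsmul_eq_mul, zsmul_eq_mul, zsmul_eq_mul, zsmul_eq_mul]
      simp only [w]
      rw [← h1]; push_cast; ring
    have h3 := c.linearIndependent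
    have hc : ![c 0, c 1] = c := by ext i; fin_cases i <;> rfl
    rw [← hc, LinearIndependent.pair_iff] at h3
    obtain ⟨h4, h5⟩ := h3 _ _ h2
    constructor
    · linear_combination α * h4 + β * h5 - x * hab
    · linear_combination u * h5 - v * h4 - y * hab
  have hsp : ⊤ ≤ Submodule.span ℤ (Set.range ![1, w]) := by
    rw [← c.span_eq, Submodule.span_le]
    rintro _ ⟨i, rfl⟩
    simp only [Matrix.range_cons, Matrix.range_empty, Set.union_empty, Set.singleton_union, SetLike.mem_coe]
    rw [Submodule.mem_span_pair]
    have hab' : (α : 𝓞 K) * u + β * v = 1 := by exact_mod_cast hab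
    fin_cases i
    · refine ⟨α, -v, ?_⟩
      simp only [zsmul_eq_mul, w, Fin.zero_eta]
      rw [← h1]; push_cast; linear_combination hab' * c 0
    · refine ⟨β, u, ?_⟩
      simp only [zsmul_eq_mul, w, Fin.mk_one]
      rw [← h1]; linear_combination hab' * c 1
  exact ⟨Module.Basis.mk hli hsp, by simp⟩

lemma exists_omega (K : Type*) [Field K] [NumberField K] (hK : Module.finrank ℚ K = 2) :
    ∃ (w : 𝓞 K) (t n : ℤ), (∀ x : 𝓞 K, ∃ u v : ℤ, x = u + v * w) ∧
      (∀ u v : ℤ, (u : 𝓞 K) + v * w = 0 → u = 0 ∧ v = 0) ∧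
      w * w = t * w - n ∧ NumberField.discr K = t ^ 2 - 4 * n := by
  obtain ⟨b, hb⟩ := exists_basis K hK
  have hrep : ∀ x : 𝓞 K, x = b.repr x 0 + b.repr x 1 * b 1 := by
    intro x
    have := b.sum_repr x
    simpa [Fin.sum_univ_two, zsmul_eq_mul, hb] using this.symm
  have hrep' : ∀ u v : ℤ, ∀ x : 𝓞 K, x = u + v * b 1 → b.repr x 0 = u ∧ b.repr x 1 = v := by
    rintro u v x rfl
    have : (u : 𝓞 K) + v * b 1 = u • b 0 + v • b 1 := by simp [hb]
    rw [this]
    simp [-zsmul_eq_mul]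
  set w := b 1 with hwdef
  set t := b.repr (w * w) 1 with ht
  obtain ⟨n, hn⟩ : ∃ n, b.repr (w * w) 0 = -n := ⟨- b.repr (w * w) 0, by simp⟩
  have hw : w * w = t * w - n := by
    have := hrep (w * w)
    rw [hn, ← ht] at this
    rw [this]; push_cast; ring
  refine ⟨w, t, n, fun x => ⟨_, _, hrep x⟩, fun u v h => ?_, hw, ?_⟩
  · obtain ⟨h1, h2⟩ := hrep' u v 0 h.symm
    simp at h1 h2
    exact ⟨h1.symm, h2.symm⟩
  · have htr : ∀ u v : ℤ, Algebra.trace ℤ (𝓞 K) (u + v * w) = 2 * u + v * t := by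
      intro u v
      rw [Algebra.trace_eq_matrix_trace b, Matrix.trace_fin_two, Algebra.leftMulMatrix_eq_repr_mul,
        Algebra.leftMulMatrix_eq_repr_mul, ← hwdef, hb]
      rw [(hrep' u v ((u + v * w) * 1) (by ring)).1,
        (hrep' (-v * n) (u + v * t) ((u + v * w) * w) (by push_cast; linear_combination v * hw)).2]
      ring
    have h00 := htr 1 0
    have h01 := htr 0 1
    have h11 := htr (-n) t
    rw [← NumberField.discr_eq_discr K b, Algebra.discr_def, Matrix.det_fin_two]
    simp only [Algebra.traceMatrix_apply, Algebra.traceForm_apply, hb, ← hwdef, mul_one, one_mul]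
    rw [show (1 : 𝓞 K) = (1 : ℤ) + (0 : ℤ) * w by simp, h00,
      show w * w = (-n : ℤ) + t * w by rw [hw]; push_cast; ring, h11,
      show Algebra.trace ℤ (𝓞 K) w = t by simpa using h01]
    ring

section Local

variable {K : Type*} [Field K] [NumberField K] {w : 𝓞 K} {t n : ℤ}

/-- If the quadratic polynomial has no root mod `p`, then `p` is inert. -/
lemma inert_of_no_root (hrep : ∀ x : 𝓞 K, ∃ u v : ℤ, x = u + v * w)
    (hind : ∀ u v : ℤ, (u : 𝓞 K) + v * w = 0 → u = 0 ∧ v = 0)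
    (hw : w * w = t * w - n) {p : ℕ} (hp : p.Prime)
    (hno : ∀ a : ℤ, ¬ (p : ℤ) ∣ a ^ 2 - t * a + n) :
    (Ideal.span {(p : 𝓞 K)}).IsPrime := by
  have hpZ : Prime (p : ℤ) := Nat.prime_iff_prime_int.mp hp
  have hp0 : (p : 𝓞 K) ≠ 0 := by exact_mod_cast hp.ne_zero
  have hmem : ∀ u v : ℤ, (p : 𝓞 K) ∣ u + v * w ↔ (p : ℤ) ∣ u ∧ (p : ℤ) ∣ v := by
    intro u v
    constructor
    · rintro ⟨y, hy⟩
      obtain ⟨c, d, rfl⟩ := hrep y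
      obtain ⟨h1, h2⟩ := hind (u - p * c) (v - p * d) (by push_cast; linear_combination hy)
      exact ⟨⟨c, by linarith⟩, ⟨d, by linarith⟩⟩
    · rintro ⟨⟨c, rfl⟩, ⟨d, rfl⟩⟩
      exact ⟨c + d * w, by push_cast; ring⟩
  have hkey : ∀ u v : ℤ, (p : ℤ) ∣ u ^ 2 + t * u * v + n * v ^ 2 → (p : ℤ) ∣ u ∧ (p : ℤ) ∣ v := by
    intro u v h
    by_cases hv : (p : ℤ) ∣ v
    · refine ⟨?_, hv⟩
      refine hpZ.dvd_of_dvd_pow (n := 2) ?_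
      have : (p : ℤ) ∣ v * (t * u + n * v) := Dvd.dvd.mul_right hv _
      have := dvd_sub h this
      convert this using 1; ring
    · exfalso
      have hco : IsCoprime (p : ℤ) v := (hpZ.coprime_iff_not_dvd).2 hv
      obtain ⟨r, s, hrs⟩ := hco
      apply hno (-(u * s))
      have h1 : (p : ℤ) ∣ s ^ 2 * (u ^ 2 + t * u * v + n * v ^ 2) := Dvd.dvd.mul_left h _
      obtain ⟨m, hm⟩ := h1
      have hsv : s * v = 1 - r * p := by linarith
      refine ⟨m + t * u * s * r + n * r * (1 + s * v), ?_⟩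
      linear_combination hm - (t * u * s) * hrs - n * (1 + s * v) * hrs
  rw [Ideal.span_singleton_prime hp0]
  refine ⟨hp0, ?_, ?_⟩
  · intro hu
    have := (hmem 1 0).1 (by simpa using hu.dvd)
    exact hpZ.not_dvd_one this.1
  · intro x y hxy
    obtain ⟨a, b, rfl⟩ := hrep x
    obtain ⟨c, d, rfl⟩ := hrep y
    have h1 : ((a : 𝓞 K) + b * w) * (c + d * w) =
      ((a * c - b * d * n : ℤ) : 𝓞 K) + ((a * d + b * c + b * d * t : ℤ) : 𝓞 K) * w := by
      push_cast; linear_combination b * d * hw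
    rw [h1, hmem] at hxy
    obtain ⟨⟨e, he⟩, ⟨f, hf⟩⟩ := hxy
    have h2 : (p : ℤ) ∣ (a ^ 2 + t * a * b + n * b ^ 2) * (c ^ 2 + t * c * d + n * d ^ 2) := by
      have : (a ^ 2 + t * a * b + n * b ^ 2) * (c ^ 2 + t * c * d + n * d ^ 2) =
        (a * c - b * d * n) ^ 2 + t * (a * c - b * d * n) * (a * d + b * c + b * d * t) +
          n * (a * d + b * c + b * d * t) ^ 2 := by ring
      rw [this, he, hf]
      exact ⟨p * e ^ 2 + t * e * p * f + n * p * f ^ 2, by ring⟩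
    rcases hpZ.dvd_or_dvd h2 with h | h
    · left; exact (hmem _ _).2 (hkey _ _ h)
    · right; exact (hmem _ _).2 (hkey _ _ h)

lemma exists_hom_of_root (hrep : ∀ x : 𝓞 K, ∃ u v : ℤ, x = u + v * w)
    (hind : ∀ u v : ℤ, (u : 𝓞 K) + v * w = 0 → u = 0 ∧ v = 0)
    (hw : w * w = t * w - n) {p : ℕ} (a : ℤ) (ha : (p : ℤ) ∣ a ^ 2 - t * a + n) :
    ∃ f : 𝓞 K →+* ZMod p, f w = a := by
  have ha' : (a : ZMod p) ^ 2 - t * a + n = 0 := by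
    have := (ZMod.intCast_zmod_eq_zero_iff_dvd _ p).2 ha
    push_cast at this; exact this
  choose U V hUV using hrep
  have huniq : ∀ u v : ℤ, U (u + v * w) = u ∧ V (u + v * w) = v := by
    intro u v
    obtain ⟨h1, h2⟩ := hind (U (u + v * w) - u) (V (u + v * w) - v) (by
      push_cast; linear_combination - hUV (u + v * w))
    exact ⟨by linarith, by linarith⟩
  have hval : ∀ x : 𝓞 K, ∀ u v : ℤ, x = u + v * w → (U x : ZMod p) + V x * a = u + v * a := by
    rintro x u v rfl
    rw [(huniq u v).1, (huniq u v).2]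
  refine ⟨{ toFun := fun x => U x + V x * a, map_one' := ?_, map_mul' := ?_, map_zero' := ?_, map_add' := ?_ }, ?_⟩
  · rw [hval 1 1 0 (by simp)]; simp
  · intro x y
    rw [hval (x * y) (U x * U y - V x * V y * n) (U x * V y + V x * U y + V x * V y * t) (by
      conv_lhs => rw [hUV x, hUV y]
      push_cast; linear_combination V x * V y * hw)]
    push_cast
    linear_combination -(V x * V y : ZMod p) * ha'
  · rw [hval 0 0 0 (by simp)]; simp
  · intro x y
    rw [hval (x + y) (U x + U y) (V x + V y) (by
      conv_lhs => rw [hUV x, hUV y]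
      push_cast; ring)]
    push_cast
    ring
  · simp only [RingHom.coe_mk, MonoidHom.coe_mk, OneHom.coe_mk]
    rw [hval w 0 1 (by simp)]; simp

lemma absNorm_ker {p : ℕ} (f : 𝓞 K →+* ZMod p) : Ideal.absNorm (RingHom.ker f) = p := by
  have hf : Function.Surjective f := ZMod.ringHom_surjective f
  rw [Ideal.absNorm_apply, Submodule.cardQuot_apply]
  have := Nat.card_congr (RingHom.quotientKerEquivOfSurjective hf).toEquiv
  rw [Nat.card_zmod] at this
  exact this

lemma absNorm_span_p (hK : Module.finrank ℚ K = 2) (p : ℕ) :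
    Ideal.absNorm (Ideal.span {(p : 𝓞 K)}) = p ^ 2 := by
  rw [Ideal.absNorm_span_singleton]
  have : (p : 𝓞 K) = algebraMap ℤ (𝓞 K) p := by simp
  rw [this, Algebra.norm_algebraMap, NumberField.RingOfIntegers.rank, hK]
  simp [Int.natAbs_pow]

/-- If there is a root mod `p`, then `(p)` is a product of two primes of norm `p`. -/
lemma split_of_root (hK : Module.finrank ℚ K = 2)
    (hrep : ∀ x : 𝓞 K, ∃ u v : ℤ, x = u + v * w)
    (hind : ∀ u v : ℤ, (u : 𝓞 K) + v * w = 0 → u = 0 ∧ v = 0)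
    (hw : w * w = t * w - n) {p : ℕ} (hp : p.Prime) (a : ℤ)
    (ha : (p : ℤ) ∣ a ^ 2 - t * a + n) :
    ∃ P Q : Ideal (𝓞 K), Prime P ∧ Prime Q ∧ Ideal.absNorm P = p ∧ Ideal.absNorm Q = p ∧
      Ideal.span {(p : 𝓞 K)} = P * Q ∧ (P = Q ↔ (p : ℤ) ∣ t ^ 2 - 4 * n) := by
  have : Fact p.Prime := ⟨hp⟩
  have ha2 : (p : ℤ) ∣ (t - a) ^ 2 - t * (t - a) + n := by convert ha using 1; ring
  obtain ⟨f, hf⟩ := exists_hom_of_root hrep hind hw a ha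
  obtain ⟨g, hg⟩ := exists_hom_of_root hrep hind hw (t - a) ha2
  have hpZ : Prime (p : ℤ) := Nat.prime_iff_prime_int.mp hp
  have hpr : ∀ h : 𝓞 K →+* ZMod p, Prime (RingHom.ker h) := by
    intro h
    refine Ideal.prime_of_isPrime ?_ (RingHom.ker_isPrime h)
    intro h0
    have := absNorm_ker h
    rw [h0] at this
    simp at this
    exact hp.ne_zero this.symm
  refine ⟨RingHom.ker f, RingHom.ker g, hpr f, hpr g, absNorm_ker f, absNorm_ker g, ?_, ?_⟩
  · have hle : RingHom.ker f * RingHom.ker g ≤ Ideal.span {(p : 𝓞 K)} := by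
      rw [Ideal.mul_le]
      intro x hx y hy
      obtain ⟨x0, x1, rfl⟩ := hrep x
      obtain ⟨y0, y1, rfl⟩ := hrep y
      rw [RingHom.mem_ker] at hx hy
      simp only [map_add, map_mul, map_intCast, hf, hg] at hx hy
      have hx' : ((x0 + x1 * a : ℤ) : ZMod p) = 0 := by push_cast; exact hx
      have hy' : ((y0 + y1 * (t - a) : ℤ) : ZMod p) = 0 := by push_cast at hy ⊢; exact hy
      obtain ⟨c, hc⟩ := (ZMod.intCast_zmod_eq_zero_iff_dvd _ p).1 hx'
      obtain ⟨d, hd⟩ := (ZMod.intCast_zmod_eq_zero_iff_dvd _ p).1 hy'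
      obtain ⟨e, he⟩ := ha
      rw [Ideal.mem_span_singleton]
      have hc' : (x0 : 𝓞 K) + x1 * a = p * c := by exact_mod_cast congrArg (Int.cast (R := 𝓞 K)) hc
      have hd' : (y0 : 𝓞 K) + y1 * (t - a) = p * d := by
        exact_mod_cast congrArg (Int.cast (R := 𝓞 K)) hd
      have he' : (a : 𝓞 K) ^ 2 - t * a + n = p * e := by
        exact_mod_cast congrArg (Int.cast (R := 𝓞 K)) he
      refine ⟨-x1 * y1 * e + c * y1 * (w - (t - a)) + d * x1 * (w - a) + p * c * d, ?_⟩
      have e1 : (x0 : 𝓞 K) + x1 * w = x1 * (w - a) + p * c := by linear_combination hc'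
      have e2 : (y0 : 𝓞 K) + y1 * w = y1 * (w - (t - a)) + p * d := by linear_combination hd'
      rw [e1, e2]
      linear_combination x1 * y1 * hw - x1 * y1 * he'
    obtain ⟨J, hJ⟩ := Ideal.dvd_iff_le.2 hle
    have hN := congrArg Ideal.absNorm hJ
    rw [map_mul, map_mul, absNorm_ker, absNorm_ker, absNorm_span_p hK] at hN
    have : Ideal.absNorm J = 1 := by
      have hpos : 0 < p ^ 2 := pow_pos hp.pos 2
      nlinarith
    rw [Ideal.absNorm_eq_one_iff] at this
    rw [hJ, this, Ideal.mul_top]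
  · have hD : (p : ℤ) ∣ t ^ 2 - 4 * n ↔ (p : ℤ) ∣ t - 2 * a := by
      obtain ⟨e, he⟩ := ha
      constructor
      · rintro ⟨m, hm⟩
        apply hpZ.dvd_of_dvd_pow (n := 2)
        exact ⟨m + 4 * e, by linear_combination hm + 4 * he⟩
      · rintro ⟨m, hm⟩
        exact ⟨m * (t - 2 * a) - 4 * e, by linear_combination (t - 2 * a) * hm - 4 * he⟩
    rw [hD]
    constructor
    · intro h
      have : w - a ∈ RingHom.ker f := by rw [RingHom.mem_ker]; simp [hf]
      rw [h, RingHom.mem_ker] at this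
      simp only [map_sub, hg, map_intCast] at this
      rw [← ZMod.intCast_zmod_eq_zero_iff_dvd]
      push_cast at this ⊢; linear_combination this
    · intro h
      rw [← ZMod.intCast_zmod_eq_zero_iff_dvd] at h
      push_cast at h
      congr 1
      ext x
      obtain ⟨x0, x1, rfl⟩ := hrep x
      simp only [map_add, map_mul, map_intCast, hf, hg]
      push_cast
      linear_combination -(x1 : ZMod p) * h

end Local

section Count

variable {K : Type*} [Field K] [NumberField K]

lemma dvd_span_pow_of_absNorm {p k : ℕ} {I : Ideal (𝓞 K)} (hI : Ideal.absNorm I = p ^ k) :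
    I ∣ Ideal.span {(p : 𝓞 K)} ^ k := by
  rw [Ideal.dvd_iff_le, Ideal.span_singleton_pow, Ideal.span_singleton_le_iff_mem]
  have := Ideal.absNorm_mem I
  rw [hI] at this
  exact_mod_cast this

lemma count_inert (hK : Module.finrank ℚ K = 2) {p : ℕ} (hp : p.Prime)
    (h : (Ideal.span {(p : 𝓞 K)}).IsPrime) (k : ℕ) :
    (Nat.card {I : Ideal (𝓞 K) // Ideal.absNorm I = p ^ k} : ℤ) =
      ∑ j ∈ Finset.range (k + 1), (-1 : ℤ) ^ j := by
  have hp0 : (p : 𝓞 K) ≠ 0 := by exact_mod_cast hp.ne_zero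
  have hP : Prime (Ideal.span {(p : 𝓞 K)}) := Ideal.prime_of_isPrime (by simpa using hp0) h
  have hform : ∀ I : Ideal (𝓞 K), Ideal.absNorm I = p ^ k →
      ∃ i, I = Ideal.span {(p : 𝓞 K)} ^ i ∧ 2 * i = k := by
    intro I hI
    obtain ⟨i, -, hi⟩ := (dvd_prime_pow hP k).1 (dvd_span_pow_of_absNorm hI)
    rw [associated_iff_eq] at hi
    refine ⟨i, hi, ?_⟩
    rw [hi, map_pow, absNorm_span_p hK, ← pow_mul] at hI
    exact Nat.pow_right_injective hp.two_le hI
  rw [neg_one_geom_sum]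
  split_ifs with hk
  · norm_cast
    rw [Nat.card_eq_zero]
    left
    refine ⟨fun ⟨I, hI⟩ => ?_⟩
    obtain ⟨i, -, hi⟩ := hform I hI
    rw [Nat.even_iff] at hk
    omega
  · norm_cast
    rw [Nat.card_eq_one_iff_unique]
    have hk' : 2 * (k / 2) = k := by
      rw [Nat.even_iff] at hk
      omega
    refine ⟨⟨?_⟩, ⟨⟨Ideal.span {(p : 𝓞 K)} ^ (k / 2), ?_⟩⟩⟩
    · rintro ⟨I, hI⟩ ⟨J, hJ⟩
      obtain ⟨i, h1, hi⟩ := hform I hI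
      obtain ⟨j, h2, hj⟩ := hform J hJ
      rw [Subtype.mk_eq_mk, h1, h2, show i = j by omega]
    · rw [map_pow, absNorm_span_p hK, ← pow_mul, hk']

lemma count_ramified {p : ℕ} (hp : p.Prime) {P : Ideal (𝓞 K)} (hP : Prime P)
    (hN : Ideal.absNorm P = p) (h : Ideal.span {(p : 𝓞 K)} = P * P) (k : ℕ) :
    (Nat.card {I : Ideal (𝓞 K) // Ideal.absNorm I = p ^ k} : ℤ) = 1 := by
  norm_cast
  rw [Nat.card_eq_one_iff_unique]
  refine ⟨⟨?_⟩, ⟨⟨P ^ k, by rw [map_pow, hN]⟩⟩⟩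
  have key : ∀ I : Ideal (𝓞 K), Ideal.absNorm I = p ^ k → I = P ^ k := by
    intro I hI
    have := dvd_span_pow_of_absNorm hI
    rw [h, ← pow_two, ← pow_mul] at this
    obtain ⟨i, -, hi⟩ := (dvd_prime_pow hP _).1 this
    rw [associated_iff_eq] at hi
    rw [hi, map_pow, hN] at hI
    rw [hi, Nat.pow_right_injective hp.two_le hI]
  rintro ⟨I, hI⟩ ⟨J, hJ⟩
  rw [Subtype.mk_eq_mk, key I hI, key J hJ]

lemma count_split {p : ℕ} (hp : p.Prime) {P Q : Ideal (𝓞 K)} (hP : Prime P) (hQ : Prime Q)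
    (hNP : Ideal.absNorm P = p) (hNQ : Ideal.absNorm Q = p)
    (h : Ideal.span {(p : 𝓞 K)} = P * Q) (hPQ : P ≠ Q) (k : ℕ) :
    (Nat.card {I : Ideal (𝓞 K) // Ideal.absNorm I = p ^ k} : ℤ) = k + 1 := by
  norm_cast
  have hinj : ∀ i j d : ℕ, P ^ i * Q ^ (j + d) = P ^ (i + d) * Q ^ j → d = 0 := by
    intro i j d hd
    by_contra hd0
    have h1 : Q ^ d = P ^ d := by
      rw [pow_add, pow_add] at hd
      have h2 : (P ^ i * Q ^ j) * Q ^ d = (P ^ i * Q ^ j) * P ^ d := by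
        rw [mul_assoc, hd, mul_assoc, mul_assoc, mul_comm (P ^ d)]
      exact mul_left_cancel₀ (mul_ne_zero (pow_ne_zero _ hP.ne_zero) (pow_ne_zero _ hQ.ne_zero)) h2
    have h3 : P ∣ Q := hP.dvd_of_dvd_pow (h1 ▸ dvd_pow_self P hd0)
    exact hPQ (associated_iff_eq.1 (hP.associated_of_dvd hQ h3))
  let F : Fin (k + 1) → {I : Ideal (𝓞 K) // Ideal.absNorm I = p ^ k} := fun i =>
    ⟨P ^ (i : ℕ) * Q ^ (k - i), by
      rw [map_mul, map_pow, map_pow, hNP, hNQ, ← pow_add]; congr 1; omega⟩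
  have hF : Function.Bijective F := by
    constructor
    · have hle : ∀ i j : Fin (k + 1), (i : ℕ) ≤ j → F i = F j → i = j := by
        intro i j hij hFij
        simp only [F, Subtype.mk_eq_mk] at hFij
        obtain ⟨d, hd⟩ := Nat.exists_eq_add_of_le hij
        have := hinj i (k - j) d (by rw [← hd, ← hFij]; congr 2; omega)
        ext; omega
      intro i j hFij
      rcases le_total (i : ℕ) j with hij | hij
      · exact hle i j hij hFij
      · exact (hle j i hij hFij.symm).symm
    · rintro ⟨I, hI⟩
      have := dvd_span_pow_of_absNorm hI
      rw [h, mul_pow] at this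
      obtain ⟨A, B, hA, hB, rfl⟩ := exists_dvd_and_dvd_of_dvd_mul this
      obtain ⟨i, -, hi⟩ := (dvd_prime_pow hP _).1 hA
      obtain ⟨j, -, hj⟩ := (dvd_prime_pow hQ _).1 hB
      rw [associated_iff_eq] at hi hj
      subst hi hj
      rw [map_mul, map_pow, map_pow, hNP, hNQ, ← pow_add] at hI
      have hij := Nat.pow_right_injective hp.two_le hI
      refine ⟨⟨i, by omega⟩, ?_⟩
      simp only [F, Subtype.mk_eq_mk]
      congr 2; omega
  rw [← Nat.card_congr (Equiv.ofBijective F hF), Nat.card_fin]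

lemma count_mul {m n : ℕ} (hmn : m.Coprime n) :
    Nat.card {I : Ideal (𝓞 K) // Ideal.absNorm I = m * n} =
      Nat.card {I : Ideal (𝓞 K) // Ideal.absNorm I = m} *
        Nat.card {I : Ideal (𝓞 K) // Ideal.absNorm I = n} := by
  rw [← Nat.card_prod]
  have hco : IsCoprime (m : 𝓞 K) (n : 𝓞 K) := by
    have := (Nat.isCoprime_iff_coprime.2 hmn).map (Int.castRingHom (𝓞 K))
    simpa using this
  have htop : Ideal.span {(m : 𝓞 K)} ⊔ Ideal.span {(n : 𝓞 K)} = ⊤ :=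
    Ideal.isCoprime_iff_sup_eq.1 ((Ideal.isCoprime_span_singleton_iff _ _).2 hco)
  have hle : ∀ (I : Ideal (𝓞 K)) (a : ℕ), Ideal.absNorm I = a → Ideal.span {(a : 𝓞 K)} ≤ I := by
    rintro I a rfl
    rw [Ideal.span_singleton_le_iff_mem]
    exact Ideal.absNorm_mem I
  have hrec : ∀ {a b : ℕ} {J L : Ideal (𝓞 K)}, Ideal.span {(a : 𝓞 K)} ⊔ Ideal.span {(b : 𝓞 K)} = ⊤ →
      Ideal.absNorm J = a → Ideal.absNorm L = b → J * L ⊔ Ideal.span {(a : 𝓞 K)} = J := by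
    intro a b J L hab hJ hL
    apply le_antisymm
    · exact sup_le Ideal.mul_le_left (hle J a hJ)
    · have h1 : L ⊔ Ideal.span {(a : 𝓞 K)} = ⊤ := by
        rw [eq_top_iff, ← hab]
        exact sup_le le_sup_right ((hle L b hL).trans le_sup_left)
      calc J = J * (L ⊔ Ideal.span {(a : 𝓞 K)}) := by rw [h1, Ideal.mul_top]
        _ = J * L ⊔ J * Ideal.span {(a : 𝓞 K)} := Ideal.mul_sup _ _ _
        _ ≤ _ := sup_le_sup_left Ideal.mul_le_right _
  have hdec : ∀ I : Ideal (𝓞 K), Ideal.absNorm I = m * n →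
      (I ⊔ Ideal.span {(m : 𝓞 K)}) * (I ⊔ Ideal.span {(n : 𝓞 K)}) = I := by
    intro I hI
    have hI' := hle I _ hI
    apply le_antisymm
    · rw [Ideal.mul_sup, Ideal.sup_mul, Ideal.sup_mul]
      refine sup_le (sup_le Ideal.mul_le_right Ideal.mul_le_right) (sup_le Ideal.mul_le_left ?_)
      rw [Ideal.span_singleton_mul_span_singleton]
      exact_mod_cast hI'
    · calc I = I * (Ideal.span {(m : 𝓞 K)} ⊔ Ideal.span {(n : 𝓞 K)}) := by rw [htop, Ideal.mul_top]
        _ = I * Ideal.span {(m : 𝓞 K)} ⊔ I * Ideal.span {(n : 𝓞 K)} := Ideal.mul_sup _ _ _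
        _ ≤ _ := sup_le ?_ ?_
      · rw [mul_comm]; exact Ideal.mul_mono le_sup_right le_sup_left
      · exact Ideal.mul_mono le_sup_left le_sup_right
  have hnd : ∀ (a b : ℕ) (I : Ideal (𝓞 K)), a.Coprime b →
      (Ideal.absNorm (I ⊔ Ideal.span {(a : 𝓞 K)})).Coprime b := by
    intro a b I hab
    have h1 : Ideal.absNorm (I ⊔ Ideal.span {(a : 𝓞 K)}) ∣ Ideal.absNorm (Ideal.span {(a : 𝓞 K)}) :=
      Ideal.absNorm_dvd_absNorm_of_le le_sup_right
    have h2 : Ideal.absNorm (Ideal.span {(a : 𝓞 K)}) = a ^ Module.finrank ℤ (𝓞 K) := by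
      rw [Ideal.absNorm_span_singleton]
      have : (a : 𝓞 K) = algebraMap ℤ (𝓞 K) a := by simp
      rw [this, Algebra.norm_algebraMap]
      simp [Int.natAbs_pow]
    rw [h2] at h1
    exact Nat.Coprime.coprime_dvd_left h1 (Nat.Coprime.pow_left _ hab)
  have hnorm : ∀ I : Ideal (𝓞 K), Ideal.absNorm I = m * n →
      Ideal.absNorm (I ⊔ Ideal.span {(m : 𝓞 K)}) = m ∧
      Ideal.absNorm (I ⊔ Ideal.span {(n : 𝓞 K)}) = n := by
    intro I hI
    have h1 := congrArg Ideal.absNorm (hdec I hI)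
    rw [map_mul, hI] at h1
    have c1 := hnd m n I hmn
    have c2 := hnd n m I hmn.symm
    set x := Ideal.absNorm (I ⊔ Ideal.span {(m : 𝓞 K)})
    set y := Ideal.absNorm (I ⊔ Ideal.span {(n : 𝓞 K)})
    constructor
    · apply Nat.dvd_antisymm
      · exact c1.dvd_of_dvd_mul_right (Dvd.intro _ h1)
      · exact c2.symm.dvd_of_dvd_mul_right (Dvd.intro _ h1.symm)
    · apply Nat.dvd_antisymm
      · exact c2.dvd_of_dvd_mul_left (Dvd.intro_left _ h1)
      · exact c1.symm.dvd_of_dvd_mul_left (Dvd.intro_left _ h1.symm)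
  refine Nat.card_congr
    { toFun := fun I => (⟨_, (hnorm I.1 I.2).1⟩, ⟨_, (hnorm I.1 I.2).2⟩)
      invFun := fun JL => ⟨JL.1.1 * JL.2.1, by rw [map_mul, JL.1.2, JL.2.2]⟩
      left_inv := fun I => Subtype.ext (hdec I.1 I.2)
      right_inv := fun JL => ?_ }
  refine Prod.ext (Subtype.ext ?_) (Subtype.ext ?_)
  · exact hrec htop JL.1.2 JL.2.2
  · simp only
    rw [mul_comm]
    exact hrec (by rw [sup_comm]; exact htop) JL.2.2 JL.1.2

end Count

section Kronecker

lemma kroneckerSym_mul (D : ℤ) {m n : ℕ} (hm : m ≠ 0) (hn : n ≠ 0) :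
    kroneckerSym D (m * n) = kroneckerSym D m * kroneckerSym D n := by
  unfold kroneckerSym
  have h1 : NeZero (ordCompl[2] m) := ⟨(Nat.ordCompl_pos 2 hm).ne'⟩
  have h2 : NeZero (ordCompl[2] n) := ⟨(Nat.ordCompl_pos 2 hn).ne'⟩
  rw [Nat.ordCompl_mul, jacobiSym.mul_right, Nat.factorization_mul hm hn, Finsupp.add_apply, pow_add]
  ring

lemma kroneckerSym_one (D : ℤ) : kroneckerSym D 1 = 1 := by
  simp [kroneckerSym]

lemma kroneckerSym_pow (D : ℤ) {m : ℕ} (hm : m ≠ 0) (k : ℕ) :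
    kroneckerSym D (m ^ k) = kroneckerSym D m ^ k := by
  induction k with
  | zero => simp [kroneckerSym_one]
  | succ k ih => rw [pow_succ, kroneckerSym_mul D (pow_ne_zero _ hm) hm, ih, pow_succ]

lemma kroneckerSym_abs_le (D : ℤ) (m : ℕ) : |kroneckerSym D m| ≤ 1 := by
  unfold kroneckerSym
  rw [abs_mul, abs_pow]
  have h1 : |(if D % 2 = 0 then 0 else if D % 8 = 1 ∨ D % 8 = 7 then 1 else -1 : ℤ)| ≤ 1 := by
    split_ifs <;> simp
  have h2 : |jacobiSym D (ordCompl[2] m)| ≤ 1 := by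
    rcases jacobiSym.trichotomy D (ordCompl[2] m) with h | h | h <;> rw [h] <;> simp
  exact mul_le_one₀ (pow_le_one₀ (abs_nonneg _) h1) (abs_nonneg _) h2

lemma kroneckerSym_two (D : ℤ) : kroneckerSym D 2 =
    (if D % 2 = 0 then 0 else if D % 8 = 1 ∨ D % 8 = 7 then 1 else -1) := by
  unfold kroneckerSym
  simp [Nat.prime_two.factorization_self]

lemma kroneckerSym_odd_prime (D : ℤ) {p : ℕ} [Fact p.Prime] (h2 : p ≠ 2) :
    kroneckerSym D p = legendreSym p D := by
  have hp : p.Prime := Fact.out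
  unfold kroneckerSym
  have : p.factorization 2 = 0 := by
    apply Nat.factorization_eq_zero_of_not_dvd
    intro h
    exact h2 ((Nat.prime_dvd_prime_iff_eq Nat.prime_two hp).1 h).symm
  rw [this]
  simp [jacobiSym.legendreSym.to_jacobiSym]

lemma kroneckerSym_cases (t n : ℤ) {p : ℕ} (hp : p.Prime) :
    (kroneckerSym (t ^ 2 - 4 * n) p = 0 ∧ (p : ℤ) ∣ t ^ 2 - 4 * n ∧
      ∃ a : ℤ, (p : ℤ) ∣ a ^ 2 - t * a + n) ∨
    (kroneckerSym (t ^ 2 - 4 * n) p = 1 ∧ ¬ (p : ℤ) ∣ t ^ 2 - 4 * n ∧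
      ∃ a : ℤ, (p : ℤ) ∣ a ^ 2 - t * a + n) ∨
    (kroneckerSym (t ^ 2 - 4 * n) p = -1 ∧ ∀ a : ℤ, ¬ (p : ℤ) ∣ a ^ 2 - t * a + n) := by
  have : Fact p.Prime := ⟨hp⟩
  by_cases h2 : p = 2
  · subst h2
    rw [kroneckerSym_two]
    push_cast
    rcases Int.even_or_odd' t with ⟨s, rfl | rfl⟩
    · left
      refine ⟨if_pos (by ring_nf; omega), ⟨2 * s ^ 2 - 2 * n, by ring⟩, ⟨n, ?_⟩⟩
      obtain ⟨r, hr⟩ := Int.even_mul_succ_self n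
      exact ⟨r - s * n, by linear_combination hr⟩
    · obtain ⟨r, hr⟩ := Int.even_mul_succ_self s
      have hD : (2 * s + 1) ^ 2 - 4 * n = 8 * r + 1 - 4 * n := by linear_combination 4 * hr
      rw [hD]
      right
      rcases Int.even_or_odd' n with ⟨m, rfl | rfl⟩
      · left
        refine ⟨?_, by omega, 0, ⟨m, by ring⟩⟩
        rw [if_neg (by omega), if_pos (by omega)]
      · right
        refine ⟨?_, ?_⟩
        · rw [if_neg (by omega), if_neg (by omega)]
        · rintro a ⟨c, hc⟩
          obtain ⟨q, hq⟩ := Int.even_mul_succ_self a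
          have : a * (a + 1) - 2 * (s * a) - 2 * a + 2 * m + 1 = 2 * c := by linear_combination hc
          generalize s * a = z at this
          omega
  · rw [kroneckerSym_odd_prime _ h2]
    have h20 : (2 : ZMod p) ≠ 0 := by
      intro h
      have : ((2 : ℕ) : ZMod p) = 0 := by exact_mod_cast h
      rw [ZMod.natCast_eq_zero_iff] at this
      exact h2 ((Nat.prime_dvd_prime_iff_eq hp Nat.prime_two).1 this)
    have hroot : (∃ a : ℤ, (p : ℤ) ∣ a ^ 2 - t * a + n) ↔ IsSquare ((t ^ 2 - 4 * n : ℤ) : ZMod p) := by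
      constructor
      · rintro ⟨a, ha⟩
        rw [← ZMod.intCast_zmod_eq_zero_iff_dvd] at ha
        push_cast at ha ⊢
        exact ⟨2 * a - t, by linear_combination -4 * ha⟩
      · rintro ⟨r, hr⟩
        obtain ⟨a, ha⟩ := ZMod.intCast_surjective ((t + r) / 2 : ZMod p)
        refine ⟨a, ?_⟩
        rw [← ZMod.intCast_zmod_eq_zero_iff_dvd]
        push_cast at hr ⊢
        rw [ha]
        field_simp
        linear_combination -hr
    have hdvd : (p : ℤ) ∣ t ^ 2 - 4 * n ↔ ((t ^ 2 - 4 * n : ℤ) : ZMod p) = 0 :=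
      (ZMod.intCast_zmod_eq_zero_iff_dvd _ p).symm
    rw [hdvd, hroot]
    by_cases h0 : ((t ^ 2 - 4 * n : ℤ) : ZMod p) = 0
    · left
      refine ⟨(legendreSym.eq_zero_iff p _).2 h0, h0, ?_⟩
      rw [h0]; exact IsSquare.zero
    · right
      by_cases hs : IsSquare ((t ^ 2 - 4 * n : ℤ) : ZMod p)
      · left; exact ⟨(legendreSym.eq_one_iff p h0).2 hs, h0, hs⟩
      · right
        refine ⟨(legendreSym.eq_neg_one_iff p).2 hs, ?_⟩
        intro a ha
        exact hs (hroot.1 ⟨a, ha⟩)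

end Kronecker

section Main

open ArithmeticFunction

variable (K : Type*) [Field K] [NumberField K]

/-- The ideal counting function as an arithmetic function. -/
noncomputable def idealCount : ArithmeticFunction ℤ :=
  ⟨fun n => if n = 0 then 0 else (Nat.card {I : Ideal (𝓞 K) // Ideal.absNorm I = n} : ℤ), by simp⟩

/-- The Kronecker symbol as an arithmetic function. -/
noncomputable def kroneckerArith (D : ℤ) : ArithmeticFunction ℤ :=
  ⟨fun n => if n = 0 then 0 else kroneckerSym D n, by simp⟩

lemma idealCount_apply {n : ℕ} (hn : n ≠ 0) :
    idealCount K n = (Nat.card {I : Ideal (𝓞 K) // Ideal.absNorm I = n} : ℤ) := by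
  simp [idealCount, hn]

lemma kroneckerArith_apply (D : ℤ) {n : ℕ} (hn : n ≠ 0) :
    kroneckerArith D n = kroneckerSym D n := by
  simp [kroneckerArith, hn]

lemma idealCount_isMultiplicative : (idealCount K).IsMultiplicative := by
  rw [IsMultiplicative.iff_ne_zero]
  constructor
  · rw [idealCount_apply K one_ne_zero]
    norm_cast
    rw [Nat.card_eq_one_iff_unique]
    refine ⟨⟨?_⟩, ⟨⟨⊤, by simp⟩⟩⟩
    rintro ⟨I, hI⟩ ⟨J, hJ⟩
    rw [Ideal.absNorm_eq_one_iff] at hI hJ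
    rw [Subtype.mk_eq_mk, hI, hJ]
  · intro m n hm hn hmn
    rw [idealCount_apply K hm, idealCount_apply K hn, idealCount_apply K (mul_ne_zero hm hn),
      count_mul hmn]
    push_cast; rfl

lemma kroneckerArith_isMultiplicative (D : ℤ) : (kroneckerArith D).IsMultiplicative := by
  rw [IsMultiplicative.iff_ne_zero]
  constructor
  · rw [kroneckerArith_apply _ one_ne_zero, kroneckerSym_one]
  · intro m n hm hn hmn
    rw [kroneckerArith_apply _ hm, kroneckerArith_apply _ hn,
      kroneckerArith_apply _ (mul_ne_zero hm hn), kroneckerSym_mul D hm hn]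

lemma idealCount_eq (hK : Module.finrank ℚ K = 2) :
    idealCount K = (zeta : ArithmeticFunction ℤ) * kroneckerArith (NumberField.discr K) := by
  rw [IsMultiplicative.eq_iff_eq_on_prime_powers _ (idealCount_isMultiplicative K) _
    (isMultiplicative_zeta.natCast.mul (kroneckerArith_isMultiplicative _))]
  intro p k hp
  have hp0 := hp.ne_zero
  rw [coe_zeta_mul_apply, Nat.sum_divisors_prime_pow hp, idealCount_apply K (pow_ne_zero _ hp0)]
  simp_rw [kroneckerArith_apply _ (pow_ne_zero _ hp0), kroneckerSym_pow _ hp0]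
  obtain ⟨w, t, n, hrep, hind, hw, hD⟩ := exists_omega K hK
  rw [hD]
  rcases kroneckerSym_cases t n hp with ⟨h, hd, a, ha⟩ | ⟨h, hd, a, ha⟩ | ⟨h, hno⟩
  · obtain ⟨P, Q, hP, hQ, hNP, hNQ, hPQ, heq⟩ := split_of_root hK hrep hind hw hp a ha
    obtain rfl := heq.2 hd
    rw [h, count_ramified hp hP hNP hPQ]
    simp [Finset.sum_range_succ']
  · obtain ⟨P, Q, hP, hQ, hNP, hNQ, hPQ, heq⟩ := split_of_root hK hrep hind hw hp a ha
    rw [h, count_split hp hP hQ hNP hNQ hPQ (fun h => hd (heq.1 h))]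
    simp
  · rw [h, count_inert hK hp (inert_of_no_root hrep hind hw hp hno)]

lemma kroneckerSym_LSeriesSummable (D : ℤ) {s : ℂ} (hs : 1 < s.re) :
    LSeriesSummable (fun n => ((kroneckerArith D n : ℤ) : ℂ)) s := by
  refine LSeriesSummable_of_bounded_of_one_lt_re (m := 1) (fun n hn => ?_) hs
  rw [kroneckerArith_apply _ hn, Complex.norm_intCast]
  exact_mod_cast kroneckerSym_abs_le D n

lemma idealCount_LSeries (hK : Module.finrank ℚ K = 2) {s : ℂ} (hs : 1 < s.re) :
    LSeriesSummable (fun n => ((idealCount K n : ℤ) : ℂ)) s ∧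
    LSeries (fun n => ((idealCount K n : ℤ) : ℂ)) s = riemannZeta s *
      LSeries (fun n => ((kroneckerArith (NumberField.discr K) n : ℤ) : ℂ)) s := by
  let χ : ArithmeticFunction ℂ := ((kroneckerArith (NumberField.discr K) : ArithmeticFunction ℤ) : ArithmeticFunction ℂ)
  have hχ : LSeriesSummable (fun n => χ n) s := by
    simpa [χ] using kroneckerSym_LSeriesSummable (NumberField.discr K) hs
  have hζ : LSeriesSummable (fun n => (zeta : ArithmeticFunction ℂ) n) s := by
    simpa using LSeriesSummable_zeta_iff.2 hs
  have heq : (fun n => ((idealCount K n : ℤ) : ℂ)) = fun n => ((zeta : ArithmeticFunction ℂ) * χ) n := by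
    ext n
    rw [idealCount_eq K hK, coe_zeta_mul_apply, coe_zeta_mul_apply]
    simp [χ]
  rw [heq]
  refine ⟨LSeriesSummable_mul hζ hχ, ?_⟩
  rw [LSeries_mul' hζ hχ, ← LSeries_zeta_eq_riemannZeta hs]
  simp [χ]

end Main

/-- For a quadratic number field `K` of discriminant `D_K`, the Dedekind zeta function
factors for `Re s > 1` as `ζ_K(s) = ζ(s) · L(s, χ_{D_K})`, where `χ_{D_K}` is the Kronecker
symbol character `(D_K/·)` modulo `|D_K|`. -/
theorem dedekindZeta_eq_riemannZeta_mul_LSeries (K : Type*) [Field K] [NumberField K]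
    (hK : Module.finrank ℚ K = 2) (s : ℂ) (hs : 1 < s.re) :
    (∑' I : {I : Ideal (𝓞 K) // I ≠ ⊥}, 1 / (Ideal.absNorm I.1 : ℂ) ^ s) =
      riemannZeta s *
        ∑' m : ℕ+, (kroneckerSym (NumberField.discr K) m : ℂ) / (m : ℂ) ^ s := by
  obtain ⟨hsum, heq⟩ := idealCount_LSeries K hK hs
  have hL : ∀ f : ℕ → ℂ, LSeries f s = ∑' m : ℕ+, f m / (m : ℂ) ^ s := by
    intro f
    rw [LSeries, ← PNat.coe_injective.tsum_eq (f := LSeries.term f s)]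
    · refine tsum_congr fun m => ?_
      rw [LSeries.term_of_ne_zero m.ne_zero]
    · intro n hn
      have hn0 : n ≠ 0 := by
        rintro rfl
        simp at hn
      exact ⟨⟨n, Nat.pos_of_ne_zero hn0⟩, rfl⟩
  have hR : LSeries (fun n => ((kroneckerArith (NumberField.discr K) n : ℤ) : ℂ)) s =
      ∑' m : ℕ+, (kroneckerSym (NumberField.discr K) m : ℂ) / (m : ℂ) ^ s := by
    rw [hL]
    refine tsum_congr fun m => ?_
    rw [kroneckerArith_apply _ m.ne_zero]
  rw [← hR, ← heq]
  let N : {I : Ideal (𝓞 K) // I ≠ ⊥} → ℕ := fun I => Ideal.absNorm I.1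
  have hN0 : ∀ I, N I ≠ 0 := fun I => by
    simpa [N, Ideal.absNorm_eq_zero_iff] using I.2
  have hfin : ∀ n, Finite {I // N I = n} := by
    intro n
    have h := Ideal.finite_setOfPred_absNorm_eq (S := 𝓞 K) n
    have : Finite {I : Ideal (𝓞 K) // Ideal.absNorm I = n} := h
    exact Finite.of_injective (β := {I : Ideal (𝓞 K) // Ideal.absNorm I = n})
      (fun I => ⟨I.1.1, I.2⟩) (fun I J h => by
        simp only [Subtype.mk_eq_mk] at h
        exact Subtype.ext (Subtype.ext h))
  have hcard : ∀ n, ((Nat.card {I // N I = n} : ℕ) : ℤ) = idealCount K n := by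
    intro n
    by_cases hn : n = 0
    · subst hn
      rw [ArithmeticFunction.map_zero]
      norm_cast
      rw [Nat.card_eq_zero]
      left
      exact ⟨fun I => hN0 I.1 I.2⟩
    · rw [idealCount_apply K hn]
      norm_cast
      refine Nat.card_congr
        { toFun := fun I => ⟨I.1.1, I.2⟩
          invFun := fun I => ⟨⟨I.1, fun h => hn (by rw [← I.2, h]; simp)⟩, I.2⟩
          left_inv := fun I => rfl
          right_inv := fun I => rfl }
  let e := Equiv.sigmaFiberEquiv N
  let F : (Σ n, {I // N I = n}) → ℂ := fun x => 1 / (x.1 : ℂ) ^ s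
  have hF : ∀ n, ∑' y : {I // N I = n}, F ⟨n, y⟩ = LSeries.term (fun n => ((idealCount K n : ℤ) : ℂ)) s n := by
    intro n
    have := hfin n
    simp only [F, tsum_const, nsmul_eq_mul]
    by_cases hn : n = 0
    · subst hn
      have h0 : Nat.card {I // N I = 0} = 0 := by
        have := hcard 0; simpa using this
      simp [h0]
    · rw [LSeries.term_of_ne_zero hn, ← hcard n]
      push_cast
      ring
  have hFn : ∀ n, ∑' y : {I // N I = n}, ‖F ⟨n, y⟩‖ = ‖LSeries.term (fun n => ((idealCount K n : ℤ) : ℂ)) s n‖ := by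
    intro n
    rw [← hF]
    simp only [F, tsum_const, nsmul_eq_mul, norm_mul, Complex.norm_natCast]
  have hFs : Summable F := by
    rw [← summable_norm_iff]
    rw [summable_sigma_of_nonneg (fun _ => norm_nonneg _)]
    refine ⟨fun n => ?_, ?_⟩
    · have := hfin n
      exact Summable.of_finite
    · simp_rw [hFn]
      exact hsum.norm
  rw [LSeries, ← e.tsum_eq]
  have h1 : ∀ x, 1 / (Ideal.absNorm (e x).1 : ℂ) ^ s = F x := by
    rintro ⟨n, I, hI⟩
    simp only [F, e, Equiv.sigmaFiberEquiv_apply]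
    rw [← hI]
  rw [tsum_congr h1, hFs.tsum_sigma' (fun n => by have := hfin n; exact Summable.of_finite)]
  exact tsum_congr hF
end

section
/- Let χ be a primitive Dirichlet character mod f with χ(-1) = -1 (an odd character). Then for every nonnegative integer n, L(2n+1, χ) = (-1)^{n+1} · (τ(χ)/(2i)) · (2π/f)^{2n+1} · B_{2n+1, χ̄} / (2n+1)!. -/
open scoped BigOperators

/-- The Gauss sum `τ(χ) = ∑_{a mod f} χ(a) e^{2πi a/f}` of a Dirichlet character mod `f`. -/
noncomputable def dirGaussSum {f : ℕ} [NeZero f] (χ : DirichletCharacter ℂ f) : ℂ :=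
  ∑ a : ZMod f, χ a * Complex.exp (2 * Real.pi * Complex.I * (a.val : ℂ) / (f : ℂ))

/-- The `k`-th generalized Bernoulli number `B_{k,χ} = f^{k-1} ∑_{a mod f} χ(a) B_k(a/f)`
attached to a Dirichlet character mod `f`, via Bernoulli polynomials. -/
noncomputable def genBernoulli {f : ℕ} [NeZero f] (χ : ZMod f → ℂ) (k : ℕ) : ℂ :=
  (f : ℂ) ^ (k - 1 : ℤ) *
    ∑ a : ZMod f, χ a * (((Polynomial.bernoulli k).eval ((a.val : ℚ) / (f : ℚ)) : ℚ) : ℂ)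

namespace LeopoldtAux

open Complex Set Filter Topology HurwitzZeta

lemma slit_aux {z : ℂ} (hz : ‖z‖ = 1) (hz1 : z ≠ 1) {t : ℝ} (ht : 0 ≤ t) :
    1 - z * cexp (-t) ∈ slitPlane := by
  left
  have h1 : cexp (-t) = ((Real.exp (-t) : ℝ) : ℂ) := by push_cast; rfl
  rw [h1, sub_re, one_re, re_mul_ofReal]
  have hre : z.re ≤ 1 := hz ▸ re_le_norm z
  have hne : z.re ≠ 1 := by
    intro h
    apply hz1
    have := Complex.sq_norm z
    rw [hz, normSq_apply, h] at this
    have him : z.im = 0 := by nlinarith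
    exact Complex.ext (by simpa using h) (by simpa using him)
  have hlt : z.re < 1 := lt_of_le_of_ne hre hne
  have he : Real.exp (-t) ≤ 1 := by simpa using ht
  have he0 := Real.exp_pos (-t)
  nlinarith

lemma tend_aux (z : ℂ) : Tendsto (fun t : ℝ => 1 - z * cexp (-t)) atTop (𝓝 1) := by
  have h : Tendsto (fun t : ℝ => cexp (-t)) atTop (𝓝 0) := by
    have : (fun t : ℝ => cexp (-t)) = fun t : ℝ => ((Real.exp (-t) : ℝ) : ℂ) := by
      ext t; push_cast; rfl
    rw [this]
    have := (continuous_ofReal.tendsto 0).comp Real.tendsto_exp_neg_atTop_nhds_zero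
    rw [ofReal_zero] at this
    exact this
  simpa using (tendsto_const_nhds (x := (1:ℂ))).sub (h.const_mul z)

lemma expZeta_one {x : ℝ} (hx : x ∈ Ioo (0 : ℝ) 1) :
    expZeta (x : UnitAddCircle) 1 = -log (1 - cexp (2 * Real.pi * I * x)) := by
  set z := cexp (2 * Real.pi * I * x) with hzdef
  have hz : ‖z‖ = 1 := by
    rw [hzdef, show 2 * (Real.pi : ℂ) * I * x = ((2 * Real.pi * x : ℝ) : ℂ) * I by push_cast; ring]
    exact norm_exp_ofReal_mul_I _
  have hz1 : z ≠ 1 := by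
    intro h
    rw [hzdef, Complex.exp_eq_one_iff] at h
    obtain ⟨n, hn⟩ := h
    have h2 : (2 * Real.pi * I : ℂ) ≠ 0 := two_pi_I_ne_zero
    have h3 : (x : ℂ) = n := by
      apply mul_left_cancel₀ h2
      rw [hn]; ring
    have h4 : x = n := by exact_mod_cast h3
    have h5 := hx.1
    have h6 := hx.2
    rw [h4] at h5 h6
    have h7 : 0 < n := by exact_mod_cast h5
    have h8 : n < 1 := by exact_mod_cast h6
    omega
  have hxne : (x : UnitAddCircle) ≠ 0 := by
    intro h
    rw [AddCircle.coe_eq_zero_iff_of_mem_Ico ⟨hx.1.le, by simpa using hx.2⟩] at h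
    exact hx.1.ne' h
  let F : ℝ → ℂ := fun t => z * cexp (-t) / (1 - z * cexp (-t))
  have hmel : ∀ s : ℂ, 1 < s.re → Gamma s * expZeta (x : UnitAddCircle) s = mellin F s := by
    intro s hs
    have h1 := (hasSum_expZeta_of_one_lt_re x hs).mul_left (Gamma s)
    have hs0 : s ≠ 0 := ne_zero_of_one_lt_re hs
    rw [← hasSum_nat_add_iff' 1] at h1
    have h2 := hasSum_mellin (a := fun n : ℕ => z ^ (n + 1)) (p := fun n => (n : ℝ) + 1) (F := F)
      (s := s) (fun i => Or.inr (by positivity)) (by linarith) ?_ ?_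
    · refine HasSum.unique (f := fun n : ℕ => Gamma s * z ^ (n + 1) / ((n : ℝ) + 1 : ℝ) ^ s) ?_ h2
      convert! h1 using 1
      · ext n
        rw [hzdef, ← Complex.exp_nat_mul]
        push_cast
        rw [mul_div_assoc]
        ring_nf
      · simp [hs0]
    · intro t ht
      have hr : ‖z * cexp (-t)‖ < 1 := by
        rw [norm_mul, hz, one_mul, Complex.norm_exp]
        simpa using ht
      have h3 := (hasSum_geometric_of_norm_lt_one hr).mul_left (z * cexp (-t))
      convert! h3 using 1
      ext n
      rw [← pow_succ', mul_pow, ← Complex.exp_nat_mul (-(t : ℂ))]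
      push_cast
      rw [neg_mul, mul_neg]
    · simp only [norm_pow, hz, one_pow]
      have := (Real.summable_one_div_nat_rpow.mpr hs)
      have := (summable_nat_add_iff 1).mpr this
      simpa using this
  have hslit : ∀ t : ℝ, 0 ≤ t → 1 - z * cexp (-t) ∈ slitPlane := fun t ht => slit_aux hz hz1 ht
  have hcont : ContinuousOn F (Ici 0) := by
    apply ContinuousOn.div (by fun_prop) (by fun_prop)
    intro t ht
    exact slitPlane_ne_zero (hslit t ht)
  have hloc : MeasureTheory.LocallyIntegrableOn F (Ioi 0) :=
    (hcont.mono Ioi_subset_Ici_self).locallyIntegrableOn measurableSet_Ioi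
  have htop : F =O[atTop] fun t : ℝ => Real.exp (-1 * t) := by
    have h1 : Tendsto (fun t : ℝ => z / (1 - z * cexp (-t))) atTop (𝓝 (z / 1)) :=
      tendsto_const_nhds.div (tend_aux z) one_ne_zero
    have h2 := h1.isBigO_one ℝ
    have h3 : (fun t : ℝ => cexp (-t)) =O[atTop] fun t : ℝ => Real.exp (-1 * t) := by
      apply Asymptotics.IsBigO.of_bound 1
      filter_upwards with t
      rw [Complex.norm_exp]
      simp
    have h4 := h2.mul h3
    refine (h4.congr_left ?_).congr_right ?_
    · intro t; simp only [F]; ring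
    · intro t; simp
  have hbot : F =O[𝓝[>] 0] fun t : ℝ => t ^ (-(0:ℝ)) := by
    have h1 : Tendsto F (𝓝[>] 0) (𝓝 (F 0)) :=
      (hcont 0 self_mem_Ici).mono_left (nhdsWithin_mono _ Ioi_subset_Ici_self)
    simpa using h1.isBigO_one ℝ
  have hdiff : DifferentiableAt ℂ (mellin F) 1 :=
    mellin_differentiableAt_of_isBigO_rpow_exp one_pos hloc htop hbot (by simp)
  have hconv : MellinConvergent F 1 :=
    mellinConvergent_of_isBigO_rpow_exp one_pos hloc htop hbot (by simp)
  have hF_int : MeasureTheory.IntegrableOn F (Ioi 0) := by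
    simpa [MellinConvergent] using hconv
  have hval : mellin F 1 = -log (1 - z) := by
    have h1 : mellin F 1 = ∫ t in Ioi 0, F t := by simp [mellin]
    rw [h1]
    have h2 : Tendsto (fun t : ℝ => log (1 - z * cexp (-t))) atTop (𝓝 (log 1)) :=
      (continuousAt_clog (by simp)).tendsto.comp (tend_aux z)
    have h3 := MeasureTheory.integral_Ioi_of_hasDerivAt_of_tendsto' (a := 0)
      (f := fun t : ℝ => log (1 - z * cexp (-t))) (f' := F) ?_ hF_int h2
    · rw [h3]; simp
    · intro t ht
      have h4 : HasDerivAt (fun t : ℝ => 1 - z * cexp (-t)) (z * cexp (-t)) t := by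
        have h5 : HasDerivAt (fun t : ℝ => cexp (-t)) (cexp (-t) * (-1)) t :=
          ((hasDerivAt_id t).ofReal_comp.neg).cexp
        convert! (h5.const_mul z).const_sub 1 using 1
        ring
      exact h4.clog_real (hslit t ht)
  have hseq : Tendsto (fun k : ℕ => (1 : ℂ) + 1 / (k + 1)) atTop (𝓝 1) := by
    simpa using (tendsto_one_div_add_atTop_nhds_zero_nat (𝕜 := ℂ)).const_add 1
  have hL : Tendsto (fun s => Gamma s * expZeta (x : UnitAddCircle) s) (𝓝 1)
      (𝓝 (Gamma 1 * expZeta (x : UnitAddCircle) 1)) := by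
    refine ContinuousAt.mul ?_ (differentiable_expZeta_of_ne_zero hxne 1).continuousAt
    refine (differentiableAt_Gamma 1 ?_).continuousAt
    intro m h
    have := congrArg re h
    simp at this
    linarith [m.cast_nonneg (α := ℝ)]
  have hA := hL.comp hseq
  have hB := hdiff.continuousAt.tendsto.comp hseq
  have hAB : (fun s => Gamma s * expZeta (x : UnitAddCircle) s) ∘ (fun k : ℕ => (1 : ℂ) + 1 / (k + 1))
      = mellin F ∘ (fun k : ℕ => (1 : ℂ) + 1 / (k + 1)) := by
    ext k
    apply hmel
    have : (1 : ℂ) + 1 / (k + 1) = ((1 + 1 / (k + 1) : ℝ) : ℂ) := by push_cast; rfl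
    simp only [this, ofReal_re]
    have : (0:ℝ) < 1 / (k + 1) := by positivity
    linarith
  rw [hAB] at hA
  have := tendsto_nhds_unique hA hB
  rw [Gamma_one, one_mul] at this
  rw [this, hval]

lemma log_aux {x : ℝ} (hx : x ∈ Ioo (0 : ℝ) 1) :
    log (1 - cexp (2 * Real.pi * I * x)) = Real.log (2 * Real.sin (Real.pi * x)) +
      (Real.pi * x - Real.pi / 2) * I := by
  have hpi := Real.pi_pos
  have hs : 0 < Real.sin (Real.pi * x) := by
    apply Real.sin_pos_of_pos_of_lt_pi
    · exact mul_pos hpi hx.1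
    · nlinarith [hx.2]
  have h2 := mul_pos two_pos hs
  have key : 1 - cexp (2 * Real.pi * I * x) =
      cexp (Real.log (2 * Real.sin (Real.pi * x)) + (Real.pi * x - Real.pi / 2) * I) := by
    rw [Complex.exp_add, ← ofReal_exp, Real.exp_log h2, sub_mul, Complex.exp_sub]
    rw [show (Real.pi : ℂ) / 2 * I = Real.pi / 2 * I by rfl, Complex.exp_pi_div_two_mul_I]
    push_cast
    rw [Complex.sin, show 2 * (Real.pi : ℂ) * I * x = Real.pi * x * I + Real.pi * x * I by ring,
      Complex.exp_add, neg_mul, Complex.exp_neg]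
    have := Complex.exp_ne_zero (Real.pi * x * I)
    field_simp
  rw [key, Complex.log_exp]
  · have h1 := hx.1
    simp
    nlinarith
  · simp
    nlinarith [hx.2]

lemma sinZeta_one {x : ℝ} (hx : x ∈ Ioo (0 : ℝ) 1) :
    sinZeta (x : UnitAddCircle) 1 = -Real.pi * (x - 1 / 2) := by
  have hx' : 1 - x ∈ Ioo (0 : ℝ) 1 := ⟨by linarith [hx.2], by linarith [hx.1]⟩
  have hneg : (-(x : UnitAddCircle)) = ((1 - x : ℝ) : UnitAddCircle) := by
    rw [AddCircle.coe_sub, AddCircle.coe_period, zero_sub]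
  rw [sinZeta_eq, hneg, expZeta_one hx, expZeta_one hx', log_aux hx, log_aux hx',
    mul_sub, mul_one, Real.sin_pi_sub]
  push_cast
  have := I_ne_zero
  field_simp
  ring

lemma sinZeta_all {x : ℝ} (hx : x ∈ Ioo (0 : ℝ) 1) (k : ℕ) :
    sinZeta x (2 * k + 1) = (-1) ^ (k + 1) * (2 * Real.pi) ^ (2 * k + 1) / 2 / (2 * k + 1).factorial *
      ((Polynomial.bernoulli (2 * k + 1)).map (algebraMap ℚ ℂ)).eval (x : ℂ) := by
  rcases eq_or_ne k 0 with rfl | hk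
  · simp [sinZeta_one hx, Polynomial.bernoulli_one]
    ring
  · exact sinZeta_two_mul_nat_add_one hk (Ioo_subset_Icc_self hx)

lemma bern_eval (k : ℕ) (q : ℚ) :
    ((Polynomial.bernoulli k).map (algebraMap ℚ ℂ)).eval (q : ℂ) =
      (((Polynomial.bernoulli k).eval q : ℚ) : ℂ) := by
  have := Polynomial.eval_map_apply (f := algebraMap ℚ ℂ) (p := Polynomial.bernoulli k) q
  simpa using this

lemma gauss_eq {f : ℕ} [NeZero f] (χ : DirichletCharacter ℂ f) :
    dirGaussSum χ = gaussSum χ ZMod.stdAddChar := by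
  unfold dirGaussSum gaussSum
  refine Finset.sum_congr rfl fun a _ => ?_
  have := ZMod.stdAddChar_coe (N := f) (a.val : ℤ)
  rw [Int.cast_natCast, ZMod.natCast_zmod_val] at this
  rw [this]
  push_cast
  rfl

lemma val_mem {f : ℕ} [NeZero f] (j : ZMod f) (hj : j ≠ 0) :
    ((j.val : ℝ) / f) ∈ Ioo (0 : ℝ) 1 := by
  have hf : (0 : ℝ) < f := by exact_mod_cast Nat.pos_of_ne_zero (NeZero.ne f)
  constructor
  · apply div_pos _ hf
    have : j.val ≠ 0 := by simpa using hj
    exact_mod_cast Nat.pos_of_ne_zero this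
  · rw [div_lt_one hf]
    exact_mod_cast ZMod.val_lt j

lemma main_sum {f : ℕ} [NeZero f] (χ : DirichletCharacter ℂ f) (hprim : χ.IsPrimitive)
    (hodd : χ.Odd) (s : ℂ) :
    (f : ℂ) * DirichletCharacter.LFunction χ s =
      -I * dirGaussSum χ * ∑ j : ZMod f, χ⁻¹ j * sinZeta (ZMod.toAddCircle j) s := by
  have hχ : Function.Odd χ := hodd.to_fun
  have hF : Function.Odd (ZMod.dft (χ : ZMod f → ℂ)) := ZMod.dft_odd_iff.mpr hχ
  have h0 : ZMod.dft (χ : ZMod f → ℂ) 0 = 0 := hF.map_zero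
  have hinv : Function.Odd (χ⁻¹ : DirichletCharacter ℂ f) := by
    intro a
    rw [MulChar.inv_apply_eq_inv', MulChar.inv_apply_eq_inv', hχ a, inv_neg]
  have h1 := ZMod.LFunction_dft (ZMod.dft (χ : ZMod f → ℂ)) (s := s) (Or.inl h0)
  have h2 : ZMod.LFunction (ZMod.dft (ZMod.dft (χ : ZMod f → ℂ))) s
      = -((f : ℂ) * DirichletCharacter.LFunction χ s) := by
    rw [ZMod.dft_dft]
    unfold DirichletCharacter.LFunction ZMod.LFunction
    simp only [hχ _, smul_eq_mul, Finset.mul_sum, ← Finset.sum_neg_distrib]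
    refine Finset.sum_congr rfl fun j _ => ?_
    ring
  have h3 : ∀ j : ZMod f, ZMod.dft (χ : ZMod f → ℂ) j = -(dirGaussSum χ * χ⁻¹ j) := by
    intro j
    rw [hprim.fourierTransform_eq_inv_mul_gaussSum, gauss_eq, hinv j]
    ring
  have hcos : ∑ j : ZMod f, χ⁻¹ j * cosZeta (ZMod.toAddCircle j) s = 0 := by
    refine (hinv.mul_even fun j => ?_).sum_eq_zero
    rw [map_neg, cosZeta_neg]
  have h4 : ∑ j : ZMod f, χ⁻¹ j * expZeta (ZMod.toAddCircle (-j)) s =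
      -I * ∑ j : ZMod f, χ⁻¹ j * sinZeta (ZMod.toAddCircle j) s := by
    have : ∀ j : ZMod f, χ⁻¹ j * expZeta (ZMod.toAddCircle (-j)) s =
        χ⁻¹ j * cosZeta (ZMod.toAddCircle j) s +
          (-I) * (χ⁻¹ j * sinZeta (ZMod.toAddCircle j) s) := by
      intro j
      rw [expZeta, map_neg, cosZeta_neg, sinZeta_neg]
      ring
    rw [Finset.sum_congr rfl fun j _ => this j, Finset.sum_add_distrib, hcos, zero_add,
      Finset.mul_sum]
  rw [h2] at h1
  simp only [h3, neg_mul, Finset.sum_neg_distrib, neg_inj, mul_assoc, ← Finset.mul_sum] at h1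
  rw [h1, h4]
  ring

end LeopoldtAux

/-- Leopoldt's formula for odd `L`-values of an odd primitive Dirichlet character:
`L(2n+1, χ) = (-1)^(n+1) (τ(χ)/(2i)) (2π/f)^(2n+1) B_{2n+1,χ̄}/(2n+1)!`. -/
theorem LFunction_odd_character_odd_value {f : ℕ} [NeZero f]
    (χ : DirichletCharacter ℂ f) (hprim : χ.IsPrimitive) (hodd : χ.Odd) (n : ℕ) :
    DirichletCharacter.LFunction χ (2 * n + 1) =
      (-1) ^ (n + 1) * (dirGaussSum χ / (2 * Complex.I)) *
          (2 * Real.pi / f : ℂ) ^ (2 * n + 1) *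
        genBernoulli (fun a => (starRingEnd ℂ) (χ a)) (2 * n + 1) /
          (Nat.factorial (2 * n + 1) : ℂ) := by
  have hf : (f : ℂ) ≠ 0 := NeZero.ne _
  have h1 := LeopoldtAux.main_sum χ hprim hodd (2 * n + 1)
  have hinv0 : (χ⁻¹ : DirichletCharacter ℂ f) 0 = 0 := by
    have h := hodd.to_fun.map_zero
    rw [MulChar.inv_apply_eq_inv', h, inv_zero]
  have h2 : ∀ j : ZMod f, χ⁻¹ j * HurwitzZeta.sinZeta (ZMod.toAddCircle j) (2 * n + 1) =
      ((-1) ^ (n + 1) * (2 * Real.pi) ^ (2 * n + 1) / 2 / (2 * n + 1).factorial) *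
        ((starRingEnd ℂ) (χ j) *
        (((Polynomial.bernoulli (2 * n + 1)).eval ((j.val : ℚ) / (f : ℚ)) : ℚ) : ℂ)) := by
    intro j
    have hs : (starRingEnd ℂ) (χ j) = χ⁻¹ j := MulChar.star_apply' χ j
    rw [hs]
    rcases eq_or_ne j 0 with rfl | hj
    · rw [hinv0]; ring
    · rw [ZMod.toAddCircle_apply, LeopoldtAux.sinZeta_all (LeopoldtAux.val_mem j hj),
        ← LeopoldtAux.bern_eval]
      push_cast
      ring
  rw [Finset.sum_congr rfl fun j _ => h2 j, ← Finset.mul_sum] at h1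
  apply mul_left_cancel₀ hf
  rw [h1]
  unfold genBernoulli
  generalize (∑ j : ZMod f, (starRingEnd ℂ) (χ j) *
        (((Polynomial.bernoulli (2 * n + 1)).eval ((j.val : ℚ) / (f : ℚ)) : ℚ) : ℂ)) = S
  have hexp : (((2 * n + 1 : ℕ) : ℤ) - 1) = ((2 * n : ℕ) : ℤ) := by push_cast; ring
  rw [hexp, zpow_natCast, div_pow, pow_succ (f : ℂ)]
  have hfac : ((2 * n + 1).factorial : ℂ) ≠ 0 := by exact_mod_cast Nat.factorial_ne_zero _
  have hI : dirGaussSum χ / (2 * Complex.I) = -Complex.I * dirGaussSum χ / 2 := by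
    rw [mul_comm (2 : ℂ), ← div_div, Complex.div_I]; ring
  rw [hI]
  field_simp
end
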